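/- Claim 5 of Proposition A.1: Let x_1, ..., x_l in R^k (l <= k) be linearly independent, let c be a nonzero vector in span(x_1, ..., x_l), set M = (1/l) * sum_{i=1}^l x_i x_i^T, fix d with M d = c, and define p_i* = |x_i^T d| / sum_j |x_j^T d| and the design xi* = {(x_i, p_i*)}. Then xi* minimizes Psi over all designs supported on {x_1, ..., x_l}: for every choice of weights p_1, ..., p_l >= 0 with sum_i p_i = 1 such that c is estimable under xi = {(x_i, p_i)}, one has Psi(xi*) <= Psi(xi). -/

import Mathlib

open Matrix BigOperators

/-- The information matrix of a design with points `x i` and weights `p i`. -/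
noncomputable def infoMat {k l : ℕ} (x : Fin l → Fin k → ℝ) (p : Fin l → ℝ) :
    Matrix (Fin k) (Fin k) ℝ :=
  ∑ i, p i • vecMulVec (x i) (x i)

/-- The optimal weight `p_i* = |x_iᵀ d| / ∑ j |x_jᵀ d|`, where `d` solves `M d = c`. -/
noncomputable def pStar {k l : ℕ} (x : Fin l → Fin k → ℝ) (d : Fin k → ℝ) (i : Fin l) : ℝ :=
  |x i ⬝ᵥ d| / ∑ j, |x j ⬝ᵥ d|

theorem infoMat_mulVec {k l : ℕ} (x : Fin l → Fin k → ℝ) (p : Fin l → ℝ) (v : Fin k → ℝ) :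
    infoMat x p *ᵥ v = ∑ i, (p i * (x i ⬝ᵥ v)) • x i := by
  simp [infoMat, Matrix.sum_mulVec, Matrix.smul_mulVec, Matrix.vecMulVec_mulVec, smul_smul]

/-- Dot products against a linearly independent family can be prescribed arbitrarily. -/
theorem LinearIndependent.exists_dotProduct_eq {k l : ℕ} {x : Fin l → Fin k → ℝ}
    (hx : LinearIndependent ℝ x) (u : Fin l → ℝ) :
    ∃ v : Fin k → ℝ, ∀ i, x i ⬝ᵥ v = u i := by
  obtain ⟨f, hf⟩ := LinearMap.exists_extend
    ((Fintype.linearCombination ℝ u).comp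
      ((Finsupp.linearEquivFunOnFinite ℝ ℝ (Fin l)).toLinearMap.comp hx.repr))
  refine ⟨fun j => f (Pi.single j 1), fun i => ?_⟩
  have hi := LinearMap.congr_fun hf ⟨x i, Submodule.subset_span (Set.mem_range_self i)⟩
  simp only [LinearMap.comp_apply, Submodule.subtype_apply, LinearEquiv.coe_coe] at hi
  rw [hx.repr_eq_single i _ rfl] at hi
  rw [LinearMap.pi_apply_eq_sum_univ f (x i)] at hi
  have hsingle (m : Fin k) : (fun j => if m = j then (1 : ℝ) else 0) = Pi.single m 1 := by
    ext j
    simp [Pi.single_apply, eq_comm]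
  simpa [dotProduct, hsingle, Fintype.linearCombination_apply, Pi.single_apply, eq_comm] using hi

/-- Claim 5 of Proposition A.1: the design `ξ* = {(x_i, p_i*)}` minimizes
`Ψ` over all designs supported on `{x₁,…,x_l}`: `c` is estimable under `ξ*`, and for every
choice of weights `p` making `c` estimable under `ξ = {(x_i, p_i)}`, `Ψ(ξ*) ≤ Ψ(ξ)`.
Here `Ψ(ξ) = cᵀ d` for any `d` with `M(ξ) d = c`. -/
theorem xiStar_minimizes_Psi {k l : ℕ} (hk : 1 ≤ k) (hl : l ≤ k)
    (x : Fin l → Fin k → ℝ) (hxLI : LinearIndependent ℝ x)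
    (c : Fin k → ℝ) (hc : c ≠ 0) (hcspan : c ∈ Submodule.span ℝ (Set.range x))
    (M : Matrix (Fin k) (Fin k) ℝ) (hM : M = (l : ℝ)⁻¹ • ∑ i, vecMulVec (x i) (x i))
    (d : Fin k → ℝ) (hd : M *ᵥ d = c) :
    (∃ dStar : Fin k → ℝ, (infoMat x (pStar x d)) *ᵥ dStar = c) ∧
    ∀ dStar : Fin k → ℝ, (infoMat x (pStar x d)) *ᵥ dStar = c →
      ∀ p : Fin l → ℝ, (∀ i, 0 ≤ p i) → ∑ i, p i = 1 →
        ∀ dξ : Fin k → ℝ, (infoMat x p) *ᵥ dξ = c →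
          c ⬝ᵥ dStar ≤ c ⬝ᵥ dξ := by
  set w : Fin l → ℝ := fun i => x i ⬝ᵥ d with hw
  set S : ℝ := ∑ j, |w j| with hS
  have hcw : c = ∑ i, (w i / l) • x i := by
    have hM' : M = infoMat x fun _ => (l : ℝ)⁻¹ := by
      rw [hM, infoMat, Finset.smul_sum]
    rw [← hd, hM', infoMat_mulVec]
    simp only [hw, div_eq_inv_mul]
  have hSpos : 0 < S := by
    refine (Finset.sum_nonneg fun i _ => abs_nonneg (w i)).lt_of_ne' fun h0 => hc ?_
    rw [hcw]
    refine Finset.sum_eq_zero fun i hi => ?_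
    have := (Finset.sum_eq_zero_iff_of_nonneg fun i _ => abs_nonneg (w i)).1 h0 i hi
    simp [abs_eq_zero.1 this]
  have hlpos : (0 : ℝ) < l := by
    rcases Nat.eq_zero_or_pos l with rfl | h
    · simp [hS] at hSpos
    · exact_mod_cast h
  have hcoef (p : Fin l → ℝ) (v : Fin k → ℝ) (h : infoMat x p *ᵥ v = c) (i : Fin l) :
      p i * (x i ⬝ᵥ v) = w i / l := by
    rw [infoMat_mulVec, hcw] at h
    have hinj := hxLI.fintypeLinearCombination_injective
    exact congrFun (hinj (by simpa only [Fintype.linearCombination_apply] using h)) i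
  have hdot (v : Fin k → ℝ) : c ⬝ᵥ v = ∑ i, w i / l * (x i ⬝ᵥ v) := by
    conv_lhs => rw [hcw]
    simp [sum_dotProduct, smul_dotProduct]
  have hp (i : Fin l) : pStar x d i = |w i| / S := rfl
  refine ⟨?_, fun dStar hStar p hp0 hp1 v hv => ?_⟩
  · obtain ⟨v, hv⟩ := hxLI.exists_dotProduct_eq fun i => (SignType.sign (w i) : ℝ) * (S / l)
    refine ⟨v, ?_⟩
    rw [infoMat_mulVec, hcw]
    refine Finset.sum_congr rfl fun i _ => ?_
    rw [hv, hp]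
    congr 1
    have := abs_mul_sign (w i)
    field_simp
    linear_combination this
  · have hval : c ⬝ᵥ dStar = (S / l) ^ 2 := by
      have hterm (i : Fin l) : w i / l * (x i ⬝ᵥ dStar) = |w i| * (S / l ^ 2) := by
        rcases eq_or_ne (w i) 0 with h0 | h0
        · simp [h0]
        · have h := hcoef _ _ hStar i
          rw [hp] at h
          have habs := abs_pos.2 h0
          have hsq := sq_abs (w i)
          field_simp at h ⊢
          apply mul_left_cancel₀ habs.ne'
          linear_combination w i * h - S * hsq
      rw [hdot, Finset.sum_congr rfl fun i _ => hterm i, ← Finset.sum_mul]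
      ring
    have hsum : S / l = ∑ i, p i * |x i ⬝ᵥ v| := by
      rw [hS, Finset.sum_div]
      refine Finset.sum_congr rfl fun i _ => ?_
      rw [← abs_of_pos hlpos, ← abs_div, ← hcoef p v hv i, abs_mul,
        abs_of_nonneg (hp0 i)]
    have hpsi : c ⬝ᵥ v = ∑ i, p i * |x i ⬝ᵥ v| ^ 2 := by
      rw [hdot]
      refine Finset.sum_congr rfl fun i _ => ?_
      rw [← hcoef p v hv i, sq_abs]
      ring
    rw [hval, hsum, hpsi]
    exact Real.pow_arith_mean_le_arith_mean_pow_of_even _ _ _ (fun i _ => hp0 i) hp1 even_two
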